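/- arXiv:2409.14806 — 2 statements merged into one kernel-verified Lean document; each statement's English description precedes it below -/
import Mathlib

section
/- Let π be a probability measure on ℝ with π0 = π((−∞, 0]) > 0 and π1 = π((0, ∞)) > 0, and let g : ℝ × [0, 1] → [0, ∞) be jointly measurable with ∫_0^1 g(θ, p) dp = 1 for every θ, such that for every θ ≤ 0 the map p ↦ g(θ, p) is monotone nondecreasing on [0,1], for every θ > 0 the map p ↦ g(θ, p) is monotone nonincreasing on [0,1], and g(0, p) = 1 for all p ∈ [0, 1]. Define BF(p) = (∫_{(0,∞)} g(θ, p) dπ(θ)/π1) / (∫_{(−∞,0]} g(θ, p) dπ(θ)/π0), assume the denominator is strictly positive for all p, and assume μ* = ∫_0^1 BF(p) dp ∈ (0, ∞). Then the rescaled Bayes factor BF/μ* is an e-variable for H0 : θ ≤ 0 versus H1 : θ > 0: for every θ0 ≤ 0, ∫_0^1 (BF(p)/μ*) g(θ0, p) dp ≤ 1. -/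
open MeasureTheory
open scoped ENNReal

/-- The binary rearrangement inequality in `ℝ≥0∞`. -/
lemma ENNReal.mul_add_mul_le_mul_add_mul_of_le {a b c d : ℝ≥0∞} (hab : a ≤ b) (hcd : c ≤ d) :
    a * d + b * c ≤ a * c + b * d := by
  obtain ⟨x, rfl⟩ := exists_add_of_le hab
  obtain ⟨y, rfl⟩ := exists_add_of_le hcd
  calc a * (c + y) + (a + x) * c
      ≤ a * (c + y) + (a + x) * c + x * y := le_self_add
    _ = a * c + (a + x) * (c + y) := by ring

/-- The rearrangement inequality for two oppositely ordered functions with values in `ℝ≥0∞`. -/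
lemma AntivaryOn.ennreal_mul_add_mul_le {α : Type*} {f h : α → ℝ≥0∞} {s : Set α}
    (hfh : AntivaryOn f h s) {p q : α} (hp : p ∈ s) (hq : q ∈ s) :
    f p * h p + f q * h q ≤ f p * h q + f q * h p := by
  rcases lt_trichotomy (h p) (h q) with hlt | heq | hgt
  · have := ENNReal.mul_add_mul_le_mul_add_mul_of_le (hfh hp hq hlt) hlt.le
    rwa [add_comm (f q * h q), add_comm (f q * h p)] at this
  · rw [heq]
  · exact ENNReal.mul_add_mul_le_mul_add_mul_of_le (hfh hq hp hgt) hgt.le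

/-- Chebyshev's integral inequality for two oppositely ordered functions with values in `ℝ≥0∞`. -/
lemma AntivaryOn.measure_mul_setLIntegral_mul_le {α : Type*} [MeasurableSpace α] {μ : Measure α}
    {f h : α → ℝ≥0∞} {s : Set α} (hs : MeasurableSet s) (hf : Measurable f) (hh : Measurable h)
    (hfh : AntivaryOn f h s) :
    μ s * ∫⁻ p in s, f p * h p ∂μ ≤ (∫⁻ p in s, f p ∂μ) * ∫⁻ p in s, h p ∂μ := by
  have hfh_meas : Measurable fun p ↦ f p * h p := hf.mul hh
  have key : ∫⁻ p in s, ∫⁻ q in s, (f p * h p + f q * h q) ∂μ ∂μ ≤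
      ∫⁻ p in s, ∫⁻ q in s, (f p * h q + f q * h p) ∂μ ∂μ :=
    setLIntegral_mono' hs fun p hp ↦ setLIntegral_mono' hs fun q hq ↦
      hfh.ennreal_mul_add_mul_le hp hq
  have hl : ∫⁻ p in s, ∫⁻ q in s, (f p * h p + f q * h q) ∂μ ∂μ =
      2 * (μ s * ∫⁻ p in s, f p * h p ∂μ) := by
    simp_rw [lintegral_add_left measurable_const, lintegral_const, Measure.restrict_apply_univ]
    rw [lintegral_add_right _ measurable_const, lintegral_mul_const _ hfh_meas,
      lintegral_const, Measure.restrict_apply_univ]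
    ring
  have hr : ∫⁻ p in s, ∫⁻ q in s, (f p * h q + f q * h p) ∂μ ∂μ =
      2 * ((∫⁻ p in s, f p ∂μ) * ∫⁻ p in s, h p ∂μ) := by
    simp_rw [lintegral_add_left (hh.const_mul _), lintegral_const_mul _ hh,
      lintegral_mul_const _ hf]
    rw [lintegral_add_left (hf.mul_const _), lintegral_mul_const _ hf, lintegral_const_mul _ hh]
    ring
  rw [hl, hr] at key
  exact (ENNReal.mul_le_mul_iff_right two_ne_zero ENNReal.ofNat_ne_top).mp key

/-- Corollary 2 combined with Example 2 of the paper: under the monotonicity conditions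
(5)–(6) for densities on `[0,1]` with `g 0` the uniform density, and with
`μ* = ∫_0^1 BF(p) dp = E_0[BF] ∈ (0, ∞)`, the rescaled Bayes factor `BF / μ*` is an
e-variable for `H0 : θ ≤ 0`: its expectation under every null parameter is at most one. -/
theorem rescaled_bayes_factor_evariable_one_sided
    (π : Measure ℝ) [IsProbabilityMeasure π]
    (hπ0 : 0 < π (Set.Iic (0 : ℝ))) (hπ1 : 0 < π (Set.Ioi (0 : ℝ)))
    (g : ℝ → ℝ → ℝ≥0∞) (hg_meas : Measurable (Function.uncurry g))
    (hg_fin : ∀ θ p, g θ p ≠ ⊤)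
    (hg_dens : ∀ θ : ℝ, ∫⁻ p in Set.Icc (0 : ℝ) 1, g θ p = 1)
    (hg_mono : ∀ θ : ℝ, θ ≤ 0 → MonotoneOn (g θ) (Set.Icc (0 : ℝ) 1))
    (hg_anti : ∀ θ : ℝ, 0 < θ → AntitoneOn (g θ) (Set.Icc (0 : ℝ) 1))
    (hg_zero : ∀ p ∈ Set.Icc (0 : ℝ) 1, g 0 p = 1)
    (BF : ℝ → ℝ≥0∞)
    (hBF : ∀ p : ℝ, BF p =
      ((∫⁻ θ in Set.Ioi (0 : ℝ), g θ p ∂π) / π (Set.Ioi (0 : ℝ))) /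
      ((∫⁻ θ in Set.Iic (0 : ℝ), g θ p ∂π) / π (Set.Iic (0 : ℝ))))
    (hden_pos : ∀ p : ℝ, 0 < ∫⁻ θ in Set.Iic (0 : ℝ), g θ p ∂π)
    (μstar : ℝ≥0∞) (hμstar : μstar = ∫⁻ p in Set.Icc (0 : ℝ) 1, BF p)
    (hμ_pos : 0 < μstar) (hμ_fin : μstar < ⊤) :
    ∀ θ0 : ℝ, θ0 ≤ 0 → ∫⁻ p in Set.Icc (0 : ℝ) 1, (BF p / μstar) * g θ0 p ≤ 1 := by
  intro θ0 hθ0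
  have hint (s : Set ℝ) : Measurable fun p ↦ ∫⁻ θ in s, g θ p ∂π :=
    hg_meas.lintegral_prod_left'
  have hBF_meas : Measurable BF := by
    rw [funext hBF]
    exact ((hint _).div_const _).div ((hint _).div_const _)
  have hBF_anti : AntitoneOn BF (Set.Icc 0 1) := by
    intro p hp q hq hpq
    rw [hBF, hBF]
    gcongr ?_ / _ / (?_ / _)
    · exact setLIntegral_mono' measurableSet_Ioi fun θ hθ ↦ hg_anti θ hθ hp hq hpq
    · exact setLIntegral_mono' measurableSet_Iic fun θ hθ ↦ hg_mono θ hθ hp hq hpq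
  have hg0 : Measurable (g θ0) := hg_meas.of_uncurry_left
  have hcheb := (hBF_anti.antivaryOn (hg_mono θ0 hθ0)).measure_mul_setLIntegral_mul_le
    (μ := volume) measurableSet_Icc hBF_meas hg0
  rw [hg_dens, ← hμstar, Real.volume_Icc, sub_zero, ENNReal.ofReal_one, one_mul, mul_one] at hcheb
  calc ∫⁻ p in Set.Icc (0 : ℝ) 1, (BF p / μstar) * g θ0 p
      = (∫⁻ p in Set.Icc (0 : ℝ) 1, BF p * g θ0 p) / μstar := by
        simp_rw [div_eq_mul_inv, mul_right_comm]
        exact lintegral_mul_const _ (hBF_meas.mul hg0)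
    _ ≤ μstar / μstar := by gcongr
    _ ≤ 1 := ENNReal.div_self_le_one
end

section
/- In the Beta p-value model, let π be any probability measure on ℝ with π0 = π((−∞, 0]) > 0 and π1 = π((0, ∞)) > 0, and define BF(p) = (∫_{(0,∞)} g_θ(p) dπ(θ)/π1) / (∫_{(−∞,0]} g_θ(p) dπ(θ)/π0), assuming the denominator is strictly positive, both integrals are finite for every p ∈ (0, 1], and BF is integrable under g_{θ0} for every θ0 ≤ 0. Then for every θ0 ≤ 0, E_{θ0}[BF] = ∫_0^1 BF(p) g_{θ0}(p) dp ≤ ∫_0^1 BF(p) dp = E_0[BF]; that is, μ* = sup_{θ0 ≤ 0} E_{θ0}[BF] is attained at θ0 = 0. -/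
open MeasureTheory

/-- The density of the p-variable in the Beta p-value model of Section 5:
`g θ p = (1 − θ) p^(−θ)` for `θ ≤ 0` (Beta(1 − θ, 1)) and
`g θ p = (1 + θ)(1 − p)^θ` for `θ > 0` (Beta(1, 1 + θ)), for `p ∈ [0, 1]`. -/
noncomputable def gBeta (θ p : ℝ) : ℝ :=
  if θ ≤ 0 then (1 - θ) * p ^ (-θ) else (1 + θ) * (1 - p) ^ θ

open Set

lemma gBeta_of_nonpos {θ : ℝ} (hθ : θ ≤ 0) (p : ℝ) : gBeta θ p = (1 - θ) * p ^ (-θ) := if_pos hθ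

lemma gBeta_of_pos {θ : ℝ} (hθ : 0 < θ) (p : ℝ) : gBeta θ p = (1 + θ) * (1 - p) ^ θ :=
  if_neg hθ.not_ge

lemma monotoneOn_gBeta {θ : ℝ} (hθ : θ ≤ 0) : MonotoneOn (gBeta θ) (Ici 0) := by
  intro p hp q _ hpq
  rw [gBeta_of_nonpos hθ, gBeta_of_nonpos hθ]
  exact mul_le_mul_of_nonneg_left (Real.rpow_le_rpow hp hpq (by linarith)) (by linarith)

lemma antitoneOn_gBeta {θ : ℝ} (hθ : 0 < θ) : AntitoneOn (gBeta θ) (Iic 1) := by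
  intro p _ q hq hpq
  rw [gBeta_of_pos hθ, gBeta_of_pos hθ]
  exact mul_le_mul_of_nonneg_left
    (Real.rpow_le_rpow (sub_nonneg.2 hq) (by linarith) hθ.le) (by linarith)

lemma gBeta_nonneg_of_pos {θ p : ℝ} (hθ : 0 < θ) (hp : p ≤ 1) : 0 ≤ gBeta θ p := by
  rw [gBeta_of_pos hθ]
  exact mul_nonneg (by linarith) (Real.rpow_nonneg (by linarith) _)

lemma integrableOn_gBeta {θ : ℝ} (hθ : θ ≤ 0) : IntegrableOn (gBeta θ) (Ioc 0 1) := by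
  have h : gBeta θ = fun p => (1 - θ) * p ^ (-θ) := funext (gBeta_of_nonpos hθ)
  rw [h, ← intervalIntegrable_iff_integrableOn_Ioc_of_le zero_le_one]
  exact (intervalIntegral.intervalIntegrable_rpow' (by linarith)).const_mul _

lemma integral_gBeta {θ : ℝ} (hθ : θ ≤ 0) : ∫ p in Ioc (0 : ℝ) 1, gBeta θ p = 1 := by
  have h : gBeta θ = fun p => (1 - θ) * p ^ (-θ) := funext (gBeta_of_nonpos hθ)
  have hne : -θ + 1 ≠ 0 := by linarith
  rw [h, ← intervalIntegral.integral_of_le zero_le_one, intervalIntegral.integral_const_mul,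
    integral_rpow (Or.inl (by linarith)), Real.one_rpow, Real.zero_rpow hne]
  field_simp
  ring

lemma exists_gBeta_eq_one {θ : ℝ} (hθ : θ ≤ 0) : ∃ c ∈ Ioc (0 : ℝ) 1, gBeta θ c = 1 := by
  rcases hθ.eq_or_lt with rfl | hlt
  · exact ⟨1, by simp, by simp [gBeta]⟩
  · have h1 : 0 < 1 - θ := by linarith
    refine ⟨(1 - θ) ^ θ⁻¹, ⟨Real.rpow_pos_of_pos h1 _,
      Real.rpow_le_one_of_one_le_of_nonpos (by linarith) (inv_nonpos.2 hθ)⟩, ?_⟩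
    rw [gBeta_of_nonpos hθ, ← Real.rpow_mul h1.le, mul_neg, inv_mul_cancel₀ hlt.ne,
      Real.rpow_neg_one, mul_inv_cancel₀ h1.ne']

/-- Multiplying an antitone function by a null density of the Beta model does not increase its
integral. -/
lemma setIntegral_mul_gBeta_le {f : ℝ → ℝ} {θ : ℝ} (hθ : θ ≤ 0) (hf : AntitoneOn f (Ioc 0 1))
    (hint : IntegrableOn f (Ioc 0 1)) (hmul : IntegrableOn (fun p => f p * gBeta θ p) (Ioc 0 1)) :
    ∫ p in Ioc (0 : ℝ) 1, f p * gBeta θ p ≤ ∫ p in Ioc (0 : ℝ) 1, f p := by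
  obtain ⟨c, hc, hgc⟩ := exists_gBeta_eq_one hθ
  have hg := integrableOn_gBeta hθ
  have hconst : IntegrableOn (fun _ : ℝ => (1 : ℝ)) (Ioc 0 1) := by simp
  have hle : ∫ p in Ioc (0 : ℝ) 1, (f p * gBeta θ p - f p) ≤
      ∫ p in Ioc (0 : ℝ) 1, f c * (gBeta θ p - 1) := by
    refine setIntegral_mono_on (hmul.sub hint) ((hg.sub hconst).const_mul _)
      measurableSet_Ioc fun p hp => ?_
    rcases le_total p c with hpc | hcp
    · have h1 := hf hp hc hpc
      have h2 := monotoneOn_gBeta hθ hp.1.le hc.1.le hpc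
      nlinarith
    · have h1 := hf hc hp hcp
      have h2 := monotoneOn_gBeta hθ hc.1.le hp.1.le hcp
      nlinarith
  rw [integral_sub hmul hint, integral_const_mul, integral_sub hg hconst, integral_gBeta hθ] at hle
  simpa using hle

/-- Identification of `μ*` in the case study of Section 5: in the Beta p-value model,
for every null parameter `θ0 ≤ 0`,
`E_{θ0}[BF] = ∫_0^1 BF(p) g_{θ0}(p) dp ≤ ∫_0^1 BF(p) dp = E_0[BF]`,
i.e. `μ* = sup_{θ0 ≤ 0} E_{θ0}[BF]` is attained at `θ0 = 0`. -/
theorem beta_model_mu_star_attained_at_zero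
    (π : Measure ℝ) [IsProbabilityMeasure π]
    (hπ0 : 0 < π (Set.Iic (0 : ℝ))) (hπ1 : 0 < π (Set.Ioi (0 : ℝ)))
    (BF : ℝ → ℝ)
    (hBF : ∀ p : ℝ, BF p =
      ((∫ θ in Set.Ioi (0 : ℝ), gBeta θ p ∂π) / (π (Set.Ioi (0 : ℝ))).toReal) /
      ((∫ θ in Set.Iic (0 : ℝ), gBeta θ p ∂π) / (π (Set.Iic (0 : ℝ))).toReal))
    (hden_pos : ∀ p ∈ Set.Ioc (0 : ℝ) 1, 0 < ∫ θ in Set.Iic (0 : ℝ), gBeta θ p ∂π)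
    (hden_int : ∀ p ∈ Set.Ioc (0 : ℝ) 1, IntegrableOn (fun θ => gBeta θ p) (Set.Iic (0 : ℝ)) π)
    (hnum_int : ∀ p ∈ Set.Ioc (0 : ℝ) 1, IntegrableOn (fun θ => gBeta θ p) (Set.Ioi (0 : ℝ)) π)
    (hBF_int : ∀ θ0 : ℝ, θ0 ≤ 0 →
      IntegrableOn (fun p => BF p * gBeta θ0 p) (Set.Icc (0 : ℝ) 1)) :
    ∀ θ0 : ℝ, θ0 ≤ 0 →
      ∫ p in Set.Icc (0 : ℝ) 1, BF p * gBeta θ0 p ≤ ∫ p in Set.Icc (0 : ℝ) 1, BF p := by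
  intro θ0 hθ0
  have hanti : AntitoneOn BF (Ioc 0 1) := by
    intro p hp q hq hpq
    rw [hBF p, hBF q]
    have hnum : ∫ θ in Ioi (0 : ℝ), gBeta θ q ∂π ≤ ∫ θ in Ioi (0 : ℝ), gBeta θ p ∂π :=
      setIntegral_mono_on (hnum_int q hq) (hnum_int p hp) measurableSet_Ioi
        fun θ hθ => antitoneOn_gBeta hθ hp.2 hq.2 hpq
    have hden : ∫ θ in Iic (0 : ℝ), gBeta θ p ∂π ≤ ∫ θ in Iic (0 : ℝ), gBeta θ q ∂π :=
      setIntegral_mono_on (hden_int p hp) (hden_int q hq) measurableSet_Iic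
        fun θ hθ => monotoneOn_gBeta hθ hp.1.le hq.1.le hpq
    have hnonneg : 0 ≤ ∫ θ in Ioi (0 : ℝ), gBeta θ p ∂π :=
      setIntegral_nonneg measurableSet_Ioi fun θ hθ => gBeta_nonneg_of_pos hθ hp.2
    have hπ0' : 0 < (π (Iic (0 : ℝ))).toReal :=
      ENNReal.toReal_pos hπ0.ne' (measure_ne_top _ _)
    exact div_le_div₀ (div_nonneg hnonneg ENNReal.toReal_nonneg)
      (div_le_div_of_nonneg_right hnum ENNReal.toReal_nonneg) (div_pos (hden_pos p hp) hπ0')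
      (div_le_div_of_nonneg_right hden hπ0'.le)
  have hint : IntegrableOn BF (Icc 0 1) := by simpa [gBeta] using hBF_int 0 le_rfl
  rw [integral_Icc_eq_integral_Ioc, integral_Icc_eq_integral_Ioc]
  exact setIntegral_mul_gBeta_le hθ0 hanti (hint.mono_set Ioc_subset_Icc_self)
    ((hBF_int θ0 hθ0).mono_set Ioc_subset_Icc_self)
end
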